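/- arXiv:2401.01953 — 5 statements merged into one kernel-verified Lean document; each statement's English description precedes it below -/
import Mathlib

section
/- Let (X, μ) be a measure space, let m₀ : X → [0,∞) be integrable with respect to μ, and let d ≥ 1 be an integer. Then there exists a function U : [0,∞) → [0,∞) such that: (i) U is twice continuously differentiable on (0,∞), U is convex, and U(r)/r → ∞ as r → ∞; (ii) setting P(r) := U′(r)·r − U(r), one has P′(r)·r − (1 − 1/d)·P(r) ≥ 0 for every r > 0, and there exists a constant K > 0 with P(r) ≤ K·r for every r > 0; (iii) the composition U ∘ m₀ is integrable with respect to μ. -/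
open MeasureTheory Filter

open scoped Topology

theorem hasDerivAt_max_zero_pow (k : ℕ) (t : ℝ) :
    HasDerivAt (fun t : ℝ => max 0 t ^ (k + 2)) ((k + 2) * max 0 t ^ (k + 1)) t := by
  rcases lt_trichotomy t 0 with ht | rfl | ht
  · rw [max_eq_left ht.le]
    have h : (fun t : ℝ => max 0 t ^ (k + 2)) =ᶠ[𝓝 t] fun _ => 0 := by
      filter_upwards [eventually_lt_nhds ht] with s hs
      simp [max_eq_left hs.le]
    simpa using (hasDerivAt_const t (0 : ℝ)).congr_of_eventuallyEq h
  · have h : (fun t : ℝ => max 0 t ^ (k + 2)) =O[𝓝 0] fun t : ℝ => ‖t - 0‖ ^ (k + 2) := by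
      refine Asymptotics.isBigO_of_le _ fun t => ?_
      rw [norm_pow, norm_pow, norm_norm, sub_zero]
      gcongr
      rw [Real.norm_of_nonneg (le_max_left 0 t)]
      exact max_le (norm_nonneg t) (le_abs_self t)
    simpa using (h.hasFDerivAt (by omega)).hasDerivAt
  · have h : (fun t : ℝ => max 0 t ^ (k + 2)) =ᶠ[𝓝 t] fun t => t ^ (k + 2) := by
      filter_upwards [eventually_gt_nhds ht] with s hs
      rw [max_eq_right hs.le]
    rw [max_eq_right ht.le]
    simpa using (hasDerivAt_pow (k + 2) t).congr_of_eventuallyEq h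

theorem contDiff_max_zero_cube : ContDiff ℝ 2 (fun t : ℝ => max 0 t ^ 3) := by
  have h : deriv (fun t : ℝ => max 0 t ^ 3) = fun t => 3 * max 0 t ^ 2 := by
    ext t
    rw [(hasDerivAt_max_zero_pow 1 t).deriv]
    norm_num
  have h' : deriv (fun t : ℝ => 3 * max 0 t ^ 2) = fun t => 6 * max 0 t := by
    ext t
    rw [((hasDerivAt_max_zero_pow 0 t).const_mul 3).deriv]
    norm_num
    ring
  rw [show (2 : WithTop ℕ∞) = 1 + 1 by norm_num, contDiff_succ_iff_deriv]
  refine ⟨fun t => (hasDerivAt_max_zero_pow 1 t).differentiableAt, by simp, ?_⟩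
  rw [h, contDiff_one_iff_deriv, h']
  exact ⟨fun t => ((hasDerivAt_max_zero_pow 0 t).const_mul 3).differentiableAt, by fun_prop⟩

/-- The truncation `(1 - b r ^ (-α))₊`. -/
noncomputable def truncation (α b r : ℝ) : ℝ := max 0 (1 - b * r ^ (-α))

/-- An elementary entropy, vanishing where `r ^ α ≤ b` and asymptotic to `r` at infinity. -/
noncomputable def elementaryEntropy (α b r : ℝ) : ℝ := r * truncation α b r ^ 3

/-- The pressure `r U'(r) - U(r)` of `U = elementaryEntropy α b`. -/
noncomputable def elementaryPressure (α b r : ℝ) : ℝ :=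
  3 * α * b * (r * (r ^ (-α) * truncation α b r ^ 2))

section Elementary

variable {α b r : ℝ}

theorem truncation_nonneg : 0 ≤ truncation α b r := le_max_left _ _

theorem truncation_le_one (hb : 0 ≤ b) (hr : 0 ≤ r) : truncation α b r ≤ 1 :=
  max_le zero_le_one (by have := Real.rpow_nonneg hr (-α); nlinarith [mul_nonneg hb this])

theorem truncation_eq_zero (hr : 0 < r) (h : r ^ α ≤ b) : truncation α b r = 0 := by
  have hp := Real.rpow_pos_of_pos hr α
  rw [truncation, max_eq_left]
  rw [Real.rpow_neg hr.le, sub_nonpos, ← div_eq_mul_inv]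
  exact (one_le_div hp).2 h

theorem elementaryEntropy_nonneg (hr : 0 ≤ r) : 0 ≤ elementaryEntropy α b r :=
  mul_nonneg hr (pow_nonneg truncation_nonneg _)

theorem elementaryEntropy_le (hb : 0 ≤ b) (hr : 0 ≤ r) : elementaryEntropy α b r ≤ r :=
  mul_le_of_le_one_right hr (pow_le_one₀ truncation_nonneg (truncation_le_one hb hr))

theorem elementaryEntropy_eq_zero (hr : 0 ≤ r) (h : r ^ α ≤ b) :
    elementaryEntropy α b r = 0 := by
  rcases hr.eq_or_lt with rfl | hr
  · simp [elementaryEntropy]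
  · simp [elementaryEntropy, truncation_eq_zero hr h]

theorem hasDerivAt_truncation_pow (k : ℕ) (hr : 0 < r) :
    HasDerivAt (fun s => truncation α b s ^ (k + 2))
      ((k + 2) * truncation α b r ^ (k + 1) * (α * b * (r ^ (-α) / r))) r := by
  have h : HasDerivAt (fun s : ℝ => 1 - b * s ^ (-α)) (α * b * (r ^ (-α) / r)) r := by
    refine (((Real.hasDerivAt_rpow_const (p := -α) (Or.inl hr.ne')).const_mul b).const_sub
      1).congr_deriv ?_
    rw [Real.rpow_sub_one hr.ne']
    ring
  exact (hasDerivAt_max_zero_pow k _).comp r h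

theorem hasDerivAt_elementaryEntropy (hr : 0 < r) :
    HasDerivAt (elementaryEntropy α b)
      (truncation α b r ^ 3 + 3 * α * b * (r ^ (-α) * truncation α b r ^ 2)) r := by
  refine ((hasDerivAt_id r).mul (hasDerivAt_truncation_pow (α := α) (b := b) 1 hr)).congr_deriv ?_
  simp only [id]
  field_simp
  push_cast
  ring

theorem hasDerivAt_rpow_mul_truncation_sq (hr : 0 < r) :
    HasDerivAt (fun s => s ^ (-α) * truncation α b s ^ 2)
      (α * r ^ (-α) * (2 * b * r ^ (-α) * truncation α b r - truncation α b r ^ 2) / r) r := by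
  refine ((Real.hasDerivAt_rpow_const (p := -α) (Or.inl hr.ne')).mul
    (hasDerivAt_truncation_pow (α := α) (b := b) 0 hr)).congr_deriv ?_
  rw [Real.rpow_sub_one hr.ne']
  field_simp
  push_cast
  ring

theorem hasDerivAt_deriv_elementaryEntropy (hr : 0 < r) :
    HasDerivAt
      (fun s => truncation α b s ^ 3 + 3 * α * b * (s ^ (-α) * truncation α b s ^ 2))
      (3 * α * b * r ^ (-α) *
        ((1 - α) * truncation α b r ^ 2 + 2 * α * b * r ^ (-α) * truncation α b r) / r) r := by
  refine ((hasDerivAt_truncation_pow 1 hr).add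
    ((hasDerivAt_rpow_mul_truncation_sq hr).const_mul (3 * α * b))).congr_deriv ?_
  field_simp
  push_cast
  ring

theorem hasDerivAt_elementaryPressure (hr : 0 < r) :
    HasDerivAt (elementaryPressure α b)
      (3 * α * b * r ^ (-α) *
        ((1 - α) * truncation α b r ^ 2 + 2 * α * b * r ^ (-α) * truncation α b r)) r := by
  refine (((hasDerivAt_id r).mul (hasDerivAt_rpow_mul_truncation_sq (α := α) (b := b)
    hr)).const_mul (3 * α * b)).congr_deriv ?_
  simp only [id]
  field_simp
  ring

theorem contDiffOn_elementaryEntropy :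
    ContDiffOn ℝ 2 (elementaryEntropy α b) (Set.Ioi 0) := by
  intro r hr
  have h : ContDiffAt ℝ 2 (fun s : ℝ => 1 - b * s ^ (-α)) r :=
    contDiffAt_const.sub (contDiffAt_const.mul
      (Real.contDiffAt_rpow_const_of_ne (ne_of_gt hr)))
  exact (contDiffAt_id.mul (contDiff_max_zero_cube.contDiffAt.comp r h)).contDiffWithinAt

theorem continuousOn_elementaryEntropy (hb : 0 ≤ b) :
    ContinuousOn (elementaryEntropy α b) (Set.Ici 0) := by
  intro r hr
  rcases (Set.mem_Ici.1 hr).eq_or_lt with rfl | hr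
  · have h0 : elementaryEntropy α b 0 = 0 := by simp [elementaryEntropy]
    rw [ContinuousWithinAt, h0]
    refine tendsto_of_tendsto_of_tendsto_of_le_of_le' tendsto_const_nhds
      (tendsto_id.mono_left nhdsWithin_le_nhds) ?_ ?_
    · filter_upwards [self_mem_nhdsWithin] with s hs using elementaryEntropy_nonneg hs
    · filter_upwards [self_mem_nhdsWithin] with s hs using elementaryEntropy_le hb hs
  · exact (hasDerivAt_elementaryEntropy hr).continuousAt.continuousWithinAt

theorem convexOn_elementaryEntropy (hα : 0 ≤ α) (hα' : α ≤ 1) (hb : 0 ≤ b) :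
    ConvexOn ℝ (Set.Ici 0) (elementaryEntropy α b) := by
  refine convexOn_of_hasDerivWithinAt2_nonneg (convex_Ici 0)
    (continuousOn_elementaryEntropy hb) (f' := fun s =>
      truncation α b s ^ 3 + 3 * α * b * (s ^ (-α) * truncation α b s ^ 2))
    (f'' := fun r => 3 * α * b * r ^ (-α) *
        ((1 - α) * truncation α b r ^ 2 + 2 * α * b * r ^ (-α) * truncation α b r) / r)
    ?_ ?_ ?_ <;> rw [interior_Ici] <;> intro r hr <;> rw [Set.mem_Ioi] at hr
  · exact (hasDerivAt_elementaryEntropy hr).hasDerivWithinAt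
  · exact (hasDerivAt_deriv_elementaryEntropy hr).hasDerivWithinAt
  · have h1 := sub_nonneg.2 hα'
    have h2 := truncation_nonneg (α := α) (b := b) (r := r)
    positivity

theorem tendsto_truncation_atTop (hα : 0 < α) :
    Tendsto (truncation α b) atTop (𝓝 1) := by
  unfold truncation
  have h := (tendsto_const_nhds (x := (0 : ℝ))).max
    ((tendsto_const_nhds (x := (1 : ℝ))).sub ((tendsto_rpow_neg_atTop hα).const_mul b))
  simpa using h

theorem measurable_elementaryEntropy : Measurable (elementaryEntropy α b) := by
  unfold elementaryEntropy truncation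
  fun_prop

end Elementary

/-- A lacunary sum bound: only the terms with `b n * w ≤ 1` contribute. -/
theorem sum_mul_max_zero_sq_le_two {b : ℕ → ℝ} (hb0 : ∀ n, 0 ≤ b n)
    (hb : ∀ n, 2 * b n ≤ b (n + 1)) {w : ℝ} (hw : 0 ≤ w) (N : ℕ) :
    ∑ n ∈ Finset.range N, b n * w * max 0 (1 - b n * w) ^ 2 ≤ 2 := by
  have hterm (n : ℕ) : b n * w * max 0 (1 - b n * w) ^ 2 ≤ b n * w := by
    have h := mul_nonneg (hb0 n) hw
    exact mul_le_of_le_one_right h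
      (pow_le_one₀ (le_max_left _ _) (max_le zero_le_one (by linarith)))
  have hgeom (N : ℕ) : ∑ n ∈ Finset.range N, b n * w * max 0 (1 - b n * w) ^ 2 ≤ b N * w := by
    induction N with
    | zero => simpa using mul_nonneg (hb0 0) hw
    | succ N ih =>
      rw [Finset.sum_range_succ]
      nlinarith [hterm N, mul_le_mul_of_nonneg_right (hb N) hw]
  induction N with
  | zero => simp
  | succ N ih =>
    rw [Finset.sum_range_succ]
    rcases le_total (b N * w) 1 with h | h
    · linarith [hterm N, hgeom N]
    · simpa [max_eq_left (sub_nonpos.2 h)] using ih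

/-- Thresholds along powers of two at which the elementary entropies of an integrable density
have summable integrals. -/
theorem exists_strictMono_lintegral_elementaryEntropy_le {X : Type*} [MeasurableSpace X]
    {μ : Measure X} {m : X → ℝ} (hm : ∀ x, 0 ≤ m x) (hint : Integrable m μ) (α : ℝ) :
    ∃ k : ℕ → ℕ, StrictMono k ∧
      ∀ n, ∫⁻ x, ‖elementaryEntropy α (2 ^ k n) (m x)‖ₑ ∂μ ≤ (1 / 2) ^ n := by
  have hlim : Tendsto (fun j : ℕ => ∫⁻ x, ‖elementaryEntropy α (2 ^ j) (m x)‖ₑ ∂μ)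
      atTop (𝓝 0) := by
    have h := tendsto_lintegral_norm_of_dominated_convergence (μ := μ) (bound := m)
      (F := fun (j : ℕ) x => elementaryEntropy α (2 ^ j) (m x)) (f := fun _ => 0)
      (fun j => (measurable_elementaryEntropy.comp_aemeasurable
        hint.aemeasurable).aestronglyMeasurable) hint.hasFiniteIntegral
      (fun j => .of_forall fun x => by
        rw [Real.norm_of_nonneg (elementaryEntropy_nonneg (hm x))]
        exact elementaryEntropy_le (by positivity) (hm x))
      (.of_forall fun x => by
        refine tendsto_const_nhds.congr' ?_
        filter_upwards [(tendsto_pow_atTop_atTop_of_one_lt (one_lt_two (α := ℝ))).eventually_ge_atTop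
          (m x ^ α)] with j hj
        exact (elementaryEntropy_eq_zero (hm x) hj).symm)
    simpa only [sub_zero, ofReal_norm] using h
  exact extraction_forall_of_eventually fun n =>
    hlim.eventually_le_const (ENNReal.pow_pos (by simp) n)

/-- Appendix B lemma: for every integrable nonnegative density `m₀` there exists a
convex, superlinear, `C²` entropy `U : [0,∞) → [0,∞)` whose pressure
`P(r) = U'(r) r - U(r)` satisfies `r P'(r) ≥ (1 - 1/d) P(r)` and `P(r) ≤ K r`,
and such that `U ∘ m₀` is integrable. -/
theorem exists_entropy_function
    {X : Type*} [MeasurableSpace X] (μ : Measure X)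
    (m₀ : X → ℝ) (hm₀ : ∀ x, 0 ≤ m₀ x) (hint : Integrable m₀ μ)
    (d : ℕ) (hd : 1 ≤ d) :
    ∃ U : ℝ → ℝ,
      (∀ r, 0 ≤ r → 0 ≤ U r) ∧
      ContDiffOn ℝ 2 U (Set.Ioi (0 : ℝ)) ∧
      ConvexOn ℝ (Set.Ici (0 : ℝ)) U ∧
      Tendsto (fun r => U r / r) atTop atTop ∧
      (∀ r > (0 : ℝ),
        deriv (fun s => deriv U s * s - U s) r * r
          - (1 - 1 / (d : ℝ)) * (deriv U r * r - U r) ≥ 0) ∧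
      (∃ K > (0 : ℝ), ∀ r > (0 : ℝ), deriv U r * r - U r ≤ K * r) ∧
      Integrable (fun x => U (m₀ x)) μ := by
  have hd' : (1 : ℝ) ≤ d := by exact_mod_cast hd
  obtain ⟨α, hα_def⟩ : ∃ α : ℝ, α = 1 / d := ⟨_, rfl⟩
  have hα : 0 < α := by rw [hα_def]; positivity
  have hα' : α ≤ 1 := by rw [hα_def]; exact (div_le_one (by positivity)).2 hd'
  rw [← hα_def]
  obtain ⟨k, hk, hk_int⟩ := exists_strictMono_lintegral_elementaryEntropy_le hm₀ hint α
  let b : ℕ → ℝ := fun n => 2 ^ k n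
  have hb0 (n : ℕ) : 0 ≤ b n := by positivity
  have hb_double (n : ℕ) : 2 * b n ≤ b (n + 1) := by
    rw [← pow_succ']
    exact pow_le_pow_right₀ one_le_two (hk n.lt_succ_self)
  have hb_mono : Monotone b := fun i j hij => pow_le_pow_right₀ one_le_two (hk.monotone hij)
  have hb_top : Tendsto b atTop atTop :=
    (tendsto_pow_atTop_atTop_of_one_lt one_lt_two).comp hk.tendsto_atTop
  let F : ℕ → ℝ → ℝ := fun N r => ∑ n ∈ Finset.range N, elementaryEntropy α (b n) r
  let P : ℕ → ℝ → ℝ := fun N r => ∑ n ∈ Finset.range N, elementaryPressure α (b n) r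
  let U : ℝ → ℝ := fun r => ∑' n, elementaryEntropy α (b n) r
  have hzero (R : ℝ) : ∃ N, ∀ n ≥ N, ∀ r ∈ Set.Icc 0 R, elementaryEntropy α (b n) r = 0 := by
    obtain ⟨N, hN⟩ := (hb_top.eventually_ge_atTop (R ^ α)).exists
    exact ⟨N, fun n hn r hr => elementaryEntropy_eq_zero hr.1
      ((Real.rpow_le_rpow hr.1 hr.2 hα.le).trans (hN.trans (hb_mono hn)))⟩
  have hsum {r : ℝ} (hr : 0 ≤ r) : HasSum (fun n => elementaryEntropy α (b n) r) (U r) := by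
    obtain ⟨N, hN⟩ := hzero r
    refine (summable_of_ne_finset_zero (s := Finset.range N) fun n hn => ?_).hasSum
    exact hN n (by simpa using hn) r ⟨hr, le_rfl⟩
  have hlocal (R : ℝ) : ∃ N, ∀ r ∈ Set.Icc 0 R, U r = F N r := by
    obtain ⟨N, hN⟩ := hzero R
    refine ⟨N, fun r hr => tsum_eq_sum fun n hn => ?_⟩
    exact hN n (by simpa using hn) r hr
  have hnear {r : ℝ} (hr : 0 < r) : ∃ N, U =ᶠ[𝓝 r] F N := by
    obtain ⟨N, hN⟩ := hlocal (r + 1)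
    refine ⟨N, ?_⟩
    filter_upwards [Icc_mem_nhds hr (lt_add_one r)] with s hs using hN s hs
  have hFP (N : ℕ) {r : ℝ} (hr : 0 < r) : deriv (F N) r * r - F N r = P N r := by
    rw [(HasDerivAt.fun_sum fun n _ => hasDerivAt_elementaryEntropy hr).deriv, Finset.sum_mul,
      ← Finset.sum_sub_distrib]
    refine Finset.sum_congr rfl fun n _ => ?_
    rw [elementaryEntropy, elementaryPressure]
    ring
  have hUP {r : ℝ} {N : ℕ} (hr : 0 < r) (h : U =ᶠ[𝓝 r] F N) :
      deriv U r * r - U r = P N r := by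
    rw [h.deriv_eq, h.eq_of_nhds, hFP N hr]
  refine ⟨U, fun r hr => (hsum hr).nonneg fun n => elementaryEntropy_nonneg hr, ?_, ?_, ?_, ?_,
    ⟨6, by norm_num, ?_⟩, ?_⟩
  · intro r hr
    obtain ⟨N, hN⟩ := hnear hr
    have h : ContDiffOn ℝ 2 (F N) (Set.Ioi 0) :=
      ContDiffOn.sum fun n _ => contDiffOn_elementaryEntropy
    exact ((h.contDiffAt (Ioi_mem_nhds hr)).congr_of_eventuallyEq hN).contDiffWithinAt
  · refine ⟨convex_Ici 0, fun x hx y hy s t hs ht hst => ?_⟩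
    have hz : 0 ≤ s • x + t • y := convex_Ici (0 : ℝ) hx hy hs ht hst
    simp only [smul_eq_mul] at hz ⊢
    refine hasSum_le (fun n => ?_) (hsum hz) (((hsum hx).mul_left s).add ((hsum hy).mul_left t))
    exact (convexOn_elementaryEntropy hα.le hα' (hb0 n)).2 hx hy hs ht hst
  · refine tendsto_atTop.2 fun M => ?_
    obtain ⟨N, hN⟩ := exists_nat_gt M
    have hlim : Tendsto (fun r => ∑ n ∈ Finset.range N, truncation α (b n) r ^ 3) atTop
        (𝓝 N) := by
      simpa using tendsto_finsetSum (Finset.range N) fun n _ =>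
        (tendsto_truncation_atTop (b := b n) hα).pow 3
    filter_upwards [hlim.eventually_const_lt hN, eventually_gt_atTop 0] with r hr hr0
    rw [le_div_iff₀ hr0]
    calc M * r ≤ (∑ n ∈ Finset.range N, truncation α (b n) r ^ 3) * r := by gcongr
      _ = ∑ n ∈ Finset.range N, elementaryEntropy α (b n) r := by
        rw [Finset.sum_mul]
        exact Finset.sum_congr rfl fun n _ => mul_comm _ _
      _ ≤ U r := sum_le_hasSum _ (fun n _ => elementaryEntropy_nonneg hr0.le) (hsum hr0.le)
  · intro r hr
    obtain ⟨N, hN⟩ := hnear hr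
    have h : (fun s => deriv U s * s - U s) =ᶠ[𝓝 r] P N := by
      filter_upwards [hN.eventuallyEq_nhds, eventually_gt_nhds hr] with s hs hs0
      exact hUP hs0 hs
    rw [h.deriv_eq, hUP hr hN,
      (HasDerivAt.fun_sum fun n _ => hasDerivAt_elementaryPressure hr).deriv, Finset.sum_mul,
      Finset.mul_sum, ← Finset.sum_sub_distrib]
    refine Finset.sum_nonneg fun n _ => ?_
    have h1 := truncation_nonneg (α := α) (b := b n) (r := r)
    have h2 := hb0 n
    calc (0 : ℝ) ≤ 6 * α ^ 2 * b n ^ 2 * (r ^ (-α)) ^ 2 * r * truncation α (b n) r := by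
          positivity
      _ = _ := by
          rw [elementaryPressure]
          ring
  · intro r hr
    obtain ⟨N, hN⟩ := hnear hr
    have h := sum_mul_max_zero_sq_le_two hb0 hb_double (Real.rpow_nonneg hr.le (-α)) N
    have hP : P N r = 3 * α * r *
        ∑ n ∈ Finset.range N, b n * r ^ (-α) * max 0 (1 - b n * r ^ (-α)) ^ 2 := by
      rw [Finset.mul_sum]
      refine Finset.sum_congr rfl fun n _ => ?_
      rw [elementaryPressure, truncation]
      ring
    rw [hUP hr hN, hP]
    calc _ ≤ 3 * α * r * 2 := by gcongr
      _ ≤ 3 * 1 * r * 2 := by gcongr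
      _ = 6 * r := by ring
  · have hmeas (n : ℕ) : AEStronglyMeasurable (fun x => elementaryEntropy α (b n) (m₀ x)) μ :=
      (measurable_elementaryEntropy.comp_aemeasurable hint.aemeasurable).aestronglyMeasurable
    refine ⟨aestronglyMeasurable_of_tendsto_ae atTop
      (f := fun N x => F N (m₀ x))
      (fun N => Finset.aestronglyMeasurable_fun_sum _ fun n _ => hmeas n)
      (.of_forall fun x => (hsum (hm₀ x)).tendsto_sum_nat), ?_⟩
    calc ∫⁻ x, ‖U (m₀ x)‖ₑ ∂μ
        ≤ ∫⁻ x, ∑' n, ‖elementaryEntropy α (b n) (m₀ x)‖ₑ ∂μ :=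
          lintegral_mono fun x => enorm_tsum_le_tsum_enorm
      _ = ∑' n, ∫⁻ x, ‖elementaryEntropy α (b n) (m₀ x)‖ₑ ∂μ :=
          lintegral_tsum fun n => (hmeas n).enorm
      _ ≤ ∑' n : ℕ, (1 / 2 : ENNReal) ^ n := ENNReal.tsum_le_tsum hk_int
      _ < ⊤ := by
          rw [ENNReal.tsum_geometric, one_div, ENNReal.one_sub_inv_two, inv_inv]
          exact ENNReal.ofNat_lt_top
end

section
/- Let (X, μ) be a measure space and let m₀ : X → [0,∞) be integrable with respect to μ. Then there exist a function Ψ : [0,∞) → [0,∞) and a constant C > 0 such that: Ψ is convex and nondecreasing; Ψ is twice differentiable on (0,∞) with 0 ≤ Ψ″(r) ≤ C/r for every r > 0; Ψ(r)/r → ∞ as r → ∞; and the composition Ψ ∘ m₀ is integrable with respect to μ. -/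
open MeasureTheory Filter

open Set Topology

theorem integrable_tsum_of_summable_integral_norm {X E : Type*} [MeasurableSpace X]
    [NormedAddCommGroup E] {μ : Measure X} {F : ℕ → X → E}
    (hF : ∀ n, Integrable (F n) μ) (hsum : ∀ x, Summable fun n => F n x)
    (hint : Summable fun n => ∫ x, ‖F n x‖ ∂μ) :
    Integrable (fun x => ∑' n, F n x) μ := by
  refine ⟨?_, ?_⟩
  · refine aestronglyMeasurable_of_tendsto_ae atTop
      (f := fun N x => ∑ n ∈ Finset.range N, F n x) (fun N => ?_)
      (ae_of_all _ fun x => (hsum x).hasSum.tendsto_sum_nat)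
    exact Finset.aestronglyMeasurable_fun_sum _ fun n _ => (hF n).1
  · calc ∫⁻ x, ‖∑' n, F n x‖ₑ ∂μ ≤ ∫⁻ x, ∑' n, ‖F n x‖ₑ ∂μ :=
          lintegral_mono fun x => enorm_tsum_le_tsum_enorm
      _ = ∑' n, ENNReal.ofReal (∫ x, ‖F n x‖ ∂μ) := by
          rw [lintegral_tsum fun n => (hF n).1.enorm]
          simp_rw [ofReal_integral_norm_eq_lintegral_enorm (hF _)]
      _ = ENNReal.ofReal (∑' n, ∫ x, ‖F n x‖ ∂μ) :=
          (ENNReal.ofReal_tsum_of_nonneg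
            (fun n => integral_nonneg fun x => norm_nonneg _) hint).symm
      _ < ⊤ := ENNReal.ofReal_lt_top

/-- A convex function which is quadratic below the scale `a` and linear above it. -/
noncomputable def quadLin (a r : ℝ) : ℝ := r ^ 2 / (a + r)

section quadLin

variable {a r : ℝ}

theorem quadLin_nonneg (ha : 0 < a) (hr : 0 ≤ r) : 0 ≤ quadLin a r := by
  unfold quadLin; positivity

theorem quadLin_le_self (ha : 0 < a) (hr : 0 ≤ r) : quadLin a r ≤ r := by
  unfold quadLin
  rw [div_le_iff₀ (by positivity)]
  nlinarith [mul_nonneg ha.le hr]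

theorem quadLin_le_sq_div (ha : 0 < a) (hr : 0 ≤ r) : quadLin a r ≤ r ^ 2 / a := by
  unfold quadLin
  gcongr
  linarith

theorem monotoneOn_quadLin (ha : 0 < a) : MonotoneOn (quadLin a) (Ici 0) := by
  intro x hx y hy hxy
  rw [mem_Ici] at hx hy
  unfold quadLin
  rw [div_le_div_iff₀ (by positivity) (by positivity)]
  have h : x ^ 2 ≤ y ^ 2 := by gcongr
  nlinarith [mul_le_mul_of_nonneg_left hxy (mul_nonneg hx hy)]

theorem tangent_le_quadLin (ha : 0 < a) (hr : 0 ≤ r) (k : ℝ) :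
    2 * k * r - k ^ 2 * (a + r) ≤ quadLin a r := by
  unfold quadLin
  rw [le_div_iff₀ (by positivity)]
  nlinarith [sq_nonneg (r - k * (a + r))]

theorem convexOn_quadLin (ha : 0 < a) : ConvexOn ℝ (Ici 0) (quadLin a) := by
  refine ⟨convex_Ici 0, fun x hx y hy s t hs ht hst => ?_⟩
  rw [mem_Ici] at hx hy
  simp only [smul_eq_mul]
  have hz : 0 ≤ s * x + t * y := by positivity
  set z := s * x + t * y with hzdef
  set k := z / (a + z) with hk
  have hk' : quadLin a z = 2 * k * z - k ^ 2 * (a + z) := by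
    rw [hk]; unfold quadLin
    have : a + z ≠ 0 := by positivity
    field_simp
    ring
  have h1 := mul_le_mul_of_nonneg_left (tangent_le_quadLin ha hx k) hs
  have h2 := mul_le_mul_of_nonneg_left (tangent_le_quadLin ha hy k) ht
  have h3 : quadLin a z = s * (2 * k * x - k ^ 2 * (a + x))
      + t * (2 * k * y - k ^ 2 * (a + y)) := by
    rw [hk', hzdef]
    linear_combination (k ^ 2 * a) * hst
  linarith

theorem hasDerivAt_quadLin (ha : 0 < a) (hr : 0 < r) :
    HasDerivAt (quadLin a) (1 - a ^ 2 / (a + r) ^ 2) r := by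
  have h : a + r ≠ 0 := by positivity
  have := ((hasDerivAt_id r).pow 2).div ((hasDerivAt_id r).const_add a) h
  refine this.congr_deriv ?_
  simp only [id]
  field_simp
  simp
  ring

theorem hasDerivAt_deriv_quadLin (ha : 0 < a) (hr : 0 < r) :
    HasDerivAt (fun r => 1 - a ^ 2 / (a + r) ^ 2) (2 * a ^ 2 / (a + r) ^ 3) r := by
  have h : a + r ≠ 0 := by positivity
  have := ((hasDerivAt_const r (a ^ 2)).div (((hasDerivAt_id r).const_add a).pow 2)
    (pow_ne_zero 2 h)).const_sub 1
  refine this.congr_deriv ?_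
  simp only [id]
  field_simp
  simp
  ring

theorem norm_deriv_quadLin_le (ha : 0 < a) (hr : 0 < r) :
    ‖1 - a ^ 2 / (a + r) ^ 2‖ ≤ 2 * r / a := by
  have h : 1 - a ^ 2 / (a + r) ^ 2 = (r ^ 2 + 2 * a * r) / (a + r) ^ 2 := by
    field_simp
    ring
  rw [h, Real.norm_of_nonneg (by positivity), div_le_div_iff₀ (by positivity) ha]
  have : 0 ≤ 3 * a * r ^ 2 + 2 * r ^ 3 := by positivity
  nlinarith

theorem norm_deriv2_quadLin_le (ha : 0 < a) (hr : 0 < r) :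
    ‖2 * a ^ 2 / (a + r) ^ 3‖ ≤ 2 / a := by
  rw [Real.norm_of_nonneg (by positivity), div_le_div_iff₀ (by positivity) ha]
  have : a ^ 3 ≤ (a + r) ^ 3 := by gcongr; linarith
  nlinarith

/-- Along a sequence of scales that at least doubles, the second derivatives are bounded by the
increments of a bounded quantity. -/
theorem deriv2_quadLin_le_sub {b : ℝ} (ha : 0 < a) (hr : 0 < r) (hab : 2 * a ≤ b) :
    2 * a ^ 2 / (a + r) ^ 3 ≤ 4 / r * (b / (b + r) - a / (a + r)) := by
  have hb : 0 < b := by linarith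
  have h : 4 / r * (b / (b + r) - a / (a + r)) = 4 * (b - a) / ((a + r) * (b + r)) := by
    field_simp
    ring
  rw [h, div_le_div_iff₀ (by positivity) (by positivity)]
  have key : 2 * a ^ 2 * (b + r) ≤ 4 * (b - a) * (a + r) ^ 2 := by
    nlinarith [mul_nonneg (sub_nonneg.2 hab)
      (by nlinarith [mul_pos ha hr] : 0 ≤ 4 * (a + r) ^ 2 - 2 * a ^ 2),
      mul_pos (sq_pos_of_pos ha) hr, mul_pos ha (sq_pos_of_pos hr)]
  nlinarith [mul_le_mul_of_nonneg_right key (by positivity : 0 ≤ a + r)]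

theorem tendsto_integral_quadLin {X : Type*} [MeasurableSpace X] {μ : Measure X} {f : X → ℝ}
    (hf : ∀ x, 0 ≤ f x) (hint : Integrable f μ) :
    Tendsto (fun a => ∫ x, quadLin a (f x) ∂μ) atTop (𝓝 0) := by
  rw [← integral_zero X ℝ (μ := μ)]
  refine tendsto_integral_filter_of_dominated_convergence f ?_ ?_ hint ?_
  · exact Eventually.of_forall fun a =>
      ((hint.1.aemeasurable.pow_const 2).div
        (hint.1.aemeasurable.const_add a)).aestronglyMeasurable
  · filter_upwards [eventually_gt_atTop 0] with a ha
    refine ae_of_all _ fun x => ?_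
    rw [Real.norm_of_nonneg (quadLin_nonneg ha (hf x))]
    exact quadLin_le_self ha (hf x)
  · refine ae_of_all _ fun x => ?_
    exact tendsto_const_nhds.div_atTop (tendsto_atTop_add_const_right _ _ tendsto_id)

theorem integrable_quadLin {X : Type*} [MeasurableSpace X] {μ : Measure X} {f : X → ℝ}
    (hf : ∀ x, 0 ≤ f x) (hint : Integrable f μ) (ha : 0 < a) :
    Integrable (fun x => quadLin a (f x)) μ := by
  refine hint.mono' ((hint.1.aemeasurable.pow_const 2).div
    (hint.1.aemeasurable.const_add a)).aestronglyMeasurable (ae_of_all _ fun x => ?_)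
  rw [Real.norm_of_nonneg (quadLin_nonneg ha (hf x))]
  exact quadLin_le_self ha (hf x)

end quadLin

theorem exists_doubling_seq {P : ℕ → ℝ → Prop} (hP : ∀ n, ∀ᶠ a in atTop, P n a) :
    ∃ a : ℕ → ℝ, (∀ n, 2 ^ n ≤ a n) ∧ (∀ n, 2 * a n ≤ a (n + 1)) ∧ ∀ n, P n (a n) := by
  choose b hb using fun n => eventually_atTop.1 (hP n)
  have hpos (n : ℕ) : 0 ≤ ∑ k ∈ Finset.range n, |b k| :=
    Finset.sum_nonneg fun _ _ => abs_nonneg _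
  refine ⟨fun n => 2 ^ n * (1 + ∑ k ∈ Finset.range (n + 1), |b k|), fun n => ?_, fun n => ?_,
    fun n => hb n _ ?_⟩
  · exact le_mul_of_one_le_right (by positivity) (by linarith [hpos (n + 1)])
  · simp only
    rw [Finset.sum_range_succ _ (n + 1), pow_succ]
    nlinarith [mul_nonneg (pow_nonneg (zero_le_two (α := ℝ)) n) (abs_nonneg (b (n + 1)))]
  · have h1 : (1 : ℝ) ≤ 2 ^ n := one_le_pow₀ one_le_two
    have h2 : b n ≤ 1 + ∑ k ∈ Finset.range (n + 1), |b k| := by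
      rw [Finset.sum_range_succ]
      linarith [hpos n, le_abs_self (b n)]
    exact h2.trans (le_mul_of_one_le_left (by linarith [hpos (n + 1)]) h1)

section series

variable {a : ℕ → ℝ}

theorem summable_inv_of_two_pow_le (h2 : ∀ n, 2 ^ n ≤ a n) : Summable fun n => (a n)⁻¹ := by
  refine Summable.of_nonneg_of_le
    (fun n => inv_nonneg.2 ((by positivity : (0 : ℝ) ≤ 2 ^ n).trans (h2 n))) (fun n => ?_)
    (summable_geometric_of_lt_one (r := (2 : ℝ)⁻¹) (by norm_num) (by norm_num))
  rw [inv_pow]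
  exact inv_anti₀ (by positivity) (h2 n)

theorem summable_quadLin (ha : ∀ n, 0 < a n) (hs : Summable fun n => (a n)⁻¹) {r : ℝ}
    (hr : 0 ≤ r) : Summable fun n => quadLin (a n) r :=
  Summable.of_nonneg_of_le (fun n => quadLin_nonneg (ha n) hr)
    (fun n => (quadLin_le_sq_div (ha n) hr).trans_eq (div_eq_mul_inv _ _)) (hs.mul_left (r ^ 2))

theorem hasDerivAt_tsum_quadLin (ha : ∀ n, 0 < a n) (hs : Summable fun n => (a n)⁻¹) {r : ℝ}
    (hr : 0 < r) : HasDerivAt (fun r => ∑' n, quadLin (a n) r)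
      (∑' n, (1 - a n ^ 2 / (a n + r) ^ 2)) r := by
  have hmem : r ∈ Ioo 0 (r + 1) := ⟨hr, by linarith⟩
  refine hasDerivAt_tsum_of_isPreconnected (hs.mul_left (2 * (r + 1))) isOpen_Ioo
    isPreconnected_Ioo (fun n y hy => hasDerivAt_quadLin (ha n) hy.1) (fun n y hy => ?_) hmem
    (summable_quadLin ha hs hr.le) hmem
  refine (norm_deriv_quadLin_le (ha n) hy.1).trans ?_
  rw [← div_eq_mul_inv]
  have := ha n
  have := hy.2
  gcongr

theorem hasDerivAt_deriv_tsum_quadLin (ha : ∀ n, 0 < a n) (hs : Summable fun n => (a n)⁻¹)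
    {r : ℝ} (hr : 0 < r) : HasDerivAt (deriv fun r => ∑' n, quadLin (a n) r)
      (∑' n, 2 * a n ^ 2 / (a n + r) ^ 3) r := by
  have h : HasDerivAt (fun r => ∑' n, (1 - a n ^ 2 / (a n + r) ^ 2))
      (∑' n, 2 * a n ^ 2 / (a n + r) ^ 3) r := by
    refine hasDerivAt_tsum_of_isPreconnected (hs.mul_left 2) isOpen_Ioi
      isPreconnected_Ioi (fun n y hy => hasDerivAt_deriv_quadLin (ha n) hy) (fun n y hy => ?_)
      (mem_Ioi.2 hr) ?_ (mem_Ioi.2 hr)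
    · exact (norm_deriv2_quadLin_le (ha n) hy).trans_eq (div_eq_mul_inv _ _)
    · exact Summable.of_norm_bounded (hs.mul_left (2 * r)) fun n =>
        (norm_deriv_quadLin_le (ha n) hr).trans_eq (div_eq_mul_inv _ _)
  refine h.congr_of_eventuallyEq ?_
  filter_upwards [Ioi_mem_nhds hr] with y hy using (hasDerivAt_tsum_quadLin ha hs hy).deriv

theorem tsum_deriv2_quadLin_le (ha : ∀ n, 0 < a n) (hd : ∀ n, 2 * a n ≤ a (n + 1)) {r : ℝ}
    (hr : 0 < r) : ∑' n, 2 * a n ^ 2 / (a n + r) ^ 3 ≤ 4 / r := by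
  refine Real.tsum_le_of_sum_range_le (fun n => by have := ha n; positivity) fun N => ?_
  calc ∑ n ∈ Finset.range N, 2 * a n ^ 2 / (a n + r) ^ 3
      ≤ ∑ n ∈ Finset.range N, 4 / r * (a (n + 1) / (a (n + 1) + r) - a n / (a n + r)) :=
        Finset.sum_le_sum fun n _ => deriv2_quadLin_le_sub (ha n) hr (hd n)
    _ = 4 / r * (a N / (a N + r) - a 0 / (a 0 + r)) := by
        rw [← Finset.mul_sum, Finset.sum_range_sub fun n => a n / (a n + r)]
    _ ≤ 4 / r * 1 := by
        have h0 : 0 ≤ a 0 / (a 0 + r) := by have := ha 0; positivity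
        have hN : a N / (a N + r) ≤ 1 := by
          have := ha N
          exact div_le_one_of_le₀ (by linarith) (by positivity)
        gcongr
        linarith
    _ = 4 / r := mul_one _

theorem tendsto_tsum_quadLin_div_atTop (ha : ∀ n, 0 < a n) (hs : Summable fun n => (a n)⁻¹) :
    Tendsto (fun r => (∑' n, quadLin (a n) r) / r) atTop atTop := by
  refine tendsto_atTop.2 fun B => ?_
  obtain ⟨N, hN⟩ := exists_nat_gt (2 * B)
  have hev : ∀ᶠ r in atTop, ∀ n ∈ Finset.range N, a n ≤ r :=
    (Finset.eventually_all _).2 fun n _ => eventually_ge_atTop (a n)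
  filter_upwards [hev, eventually_gt_atTop 0] with r hr hr0
  rw [le_div_iff₀ hr0]
  calc B * r ≤ ∑ n ∈ Finset.range N, r / 2 := by
        rw [Finset.sum_const, Finset.card_range, nsmul_eq_mul]
        nlinarith
    _ ≤ ∑ n ∈ Finset.range N, quadLin (a n) r := by
        refine Finset.sum_le_sum fun n hn => ?_
        have := ha n
        unfold quadLin
        rw [div_le_div_iff₀ two_pos (by positivity)]
        nlinarith [hr n hn]
    _ ≤ ∑' n, quadLin (a n) r :=
        (summable_quadLin ha hs hr0.le).sum_le_tsum _ fun n _ => quadLin_nonneg (ha n) hr0.le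

theorem monotoneOn_tsum_quadLin (ha : ∀ n, 0 < a n) (hs : Summable fun n => (a n)⁻¹) :
    MonotoneOn (fun r => ∑' n, quadLin (a n) r) (Ici 0) := fun _ hx _ hy hxy =>
  (summable_quadLin ha hs hx).tsum_le_tsum (fun n => monotoneOn_quadLin (ha n) hx hy hxy)
    (summable_quadLin ha hs hy)

theorem convexOn_tsum_quadLin (ha : ∀ n, 0 < a n) (hs : Summable fun n => (a n)⁻¹) :
    ConvexOn ℝ (Ici 0) (fun r => ∑' n, quadLin (a n) r) := by
  refine ⟨convex_Ici 0, fun x hx y hy s t hs' ht hst => ?_⟩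
  have hsx := (summable_quadLin ha hs hx).mul_left s
  have hsy := (summable_quadLin ha hs hy).mul_left t
  simp only [smul_eq_mul]
  rw [← tsum_mul_left, ← tsum_mul_left, ← hsx.tsum_add hsy]
  exact (summable_quadLin ha hs (convex_Ici (0 : ℝ) hx hy hs' ht hst)).tsum_le_tsum
    (fun n => (convexOn_quadLin (ha n)).2 hx hy hs' ht hst) (hsx.add hsy)

end series

/-- Step 1 of the Appendix B lemma (refined de la Vallée Poussin): for any
integrable nonnegative density `m₀` there is a convex, nondecreasing, superlinear
`Ψ : [0,∞) → [0,∞)` with `0 ≤ Ψ'' ≤ C/r` on `(0,∞)` such that `Ψ ∘ m₀` is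
integrable. -/
theorem exists_deLaValleePoussin_function
    {X : Type*} [MeasurableSpace X] (μ : Measure X)
    (m₀ : X → ℝ) (hm₀ : ∀ x, 0 ≤ m₀ x) (hint : Integrable m₀ μ) :
    ∃ Ψ : ℝ → ℝ, ∃ C > (0 : ℝ),
      (∀ r, 0 ≤ r → 0 ≤ Ψ r) ∧
      ConvexOn ℝ (Set.Ici (0 : ℝ)) Ψ ∧
      MonotoneOn Ψ (Set.Ici (0 : ℝ)) ∧
      (∀ r > (0 : ℝ), DifferentiableAt ℝ Ψ r) ∧
      (∀ r > (0 : ℝ), DifferentiableAt ℝ (deriv Ψ) r) ∧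
      (∀ r > (0 : ℝ), 0 ≤ deriv (deriv Ψ) r ∧ deriv (deriv Ψ) r ≤ C / r) ∧
      Tendsto (fun r => Ψ r / r) atTop atTop ∧
      Integrable (fun x => Ψ (m₀ x)) μ := by
  have hev (n : ℕ) : ∀ᶠ a in atTop, ∫ x, quadLin a (m₀ x) ∂μ ≤ (1 / 2) ^ n :=
    (tendsto_integral_quadLin hm₀ hint).eventually_le_const (by positivity)
  obtain ⟨a, h2, hd, hsmall⟩ := exists_doubling_seq hev
  have ha (n : ℕ) : 0 < a n := lt_of_lt_of_le (by positivity) (h2 n)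
  have hs := summable_inv_of_two_pow_le h2
  refine ⟨fun r => ∑' n, quadLin (a n) r, 4, by norm_num,
    fun r hr => tsum_nonneg fun n => quadLin_nonneg (ha n) hr,
    convexOn_tsum_quadLin ha hs, monotoneOn_tsum_quadLin ha hs,
    fun r hr => (hasDerivAt_tsum_quadLin ha hs hr).differentiableAt,
    fun r hr => (hasDerivAt_deriv_tsum_quadLin ha hs hr).differentiableAt,
    fun r hr => ?_, tendsto_tsum_quadLin_div_atTop ha hs, ?_⟩
  · rw [(hasDerivAt_deriv_tsum_quadLin ha hs hr).deriv]
    exact ⟨tsum_nonneg fun n => by have := ha n; positivity, tsum_deriv2_quadLin_le ha hd hr⟩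
  · refine integrable_tsum_of_summable_integral_norm
      (fun n => integrable_quadLin hm₀ hint (ha n))
      (fun x => summable_quadLin ha hs (hm₀ x)) ?_
    refine Summable.of_nonneg_of_le (fun n => integral_nonneg fun x => norm_nonneg _)
      (fun n => ?_) summable_geometric_two
    simp_rw [Real.norm_of_nonneg (quadLin_nonneg (ha n) (hm₀ _))]
    exact hsmall n
end

section
/- Let C > 0 and let Ψ : [0,∞) → ℝ be continuous with Ψ(0) = 0, twice differentiable on (0,∞), and satisfying 0 ≤ Ψ″(s) ≤ C/s for every s > 0. Then s·Ψ′(s) − Ψ(s) ≤ C·s for every s > 0. -/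
/-- If `Ψ` is continuous on `[0,∞)` with `Ψ(0) = 0`, twice differentiable on
`(0,∞)` with `0 ≤ Ψ'' (s) ≤ C/s`, then `s Ψ'(s) - Ψ(s) ≤ C s` for all `s > 0`. -/
theorem pressure_linear_growth
    (C : ℝ) (hC : 0 < C) (Ψ : ℝ → ℝ)
    (hcont : ContinuousOn Ψ (Set.Ici (0 : ℝ))) (h0 : Ψ 0 = 0)
    (hdiff : ∀ s > (0 : ℝ), DifferentiableAt ℝ Ψ s)
    (hdiff2 : ∀ s > (0 : ℝ), DifferentiableAt ℝ (deriv Ψ) s)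
    (hsecond : ∀ s > (0 : ℝ),
      0 ≤ deriv (deriv Ψ) s ∧ deriv (deriv Ψ) s ≤ C / s) :
    ∀ s > (0 : ℝ), s * deriv Ψ s - Ψ s ≤ C * s := by
  intro s hs
  have anti : AntitoneOn (fun t => deriv Ψ t - C * Real.log t) (Set.Ioi 0) := by
    have hd : ∀ t > (0 : ℝ), HasDerivAt (fun t => deriv Ψ t - C * Real.log t)
        (deriv (deriv Ψ) t - C * t⁻¹) t := fun t ht =>
      (hdiff2 t ht).hasDerivAt.sub ((Real.hasDerivAt_log ht.ne').const_mul C)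
    refine antitoneOn_of_deriv_nonpos (convex_Ioi 0)
      (fun t ht => (hd t ht).continuousAt.continuousWithinAt) ?_ ?_
    · rw [interior_Ioi]
      exact fun t ht => (hd t ht).differentiableAt.differentiableWithinAt
    · rw [interior_Ioi]
      intro t ht
      rw [(hd t ht).deriv, ← div_eq_mul_inv]
      exact sub_nonpos.2 (hsecond t ht).2
  have mono : MonotoneOn
      (fun t => Ψ t - t * deriv Ψ s + C * (t * Real.log s - t * Real.log t + t))
      (Set.Icc 0 s) := by
    have hd : ∀ t > (0 : ℝ), HasDerivAt
        (fun t => Ψ t - t * deriv Ψ s + C * (t * Real.log s - t * Real.log t + t))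
        (deriv Ψ t - 1 * deriv Ψ s + C * (1 * Real.log s - (Real.log t + 1) + 1)) t :=
      fun t ht => ((hdiff t ht).hasDerivAt.sub ((hasDerivAt_id t).mul_const _)).add
        (((((hasDerivAt_id t).mul_const _).sub (Real.hasDerivAt_mul_log ht.ne')).add
          (hasDerivAt_id t)).const_mul C)
    refine monotoneOn_of_deriv_nonneg (convex_Icc 0 s) ?_ ?_ ?_
    · have hlog : Continuous fun t : ℝ => t * Real.log t := Real.continuous_mul_log
      have hrest : Continuous fun t : ℝ => C * (t * Real.log s - t * Real.log t + t) := by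
        fun_prop
      exact ((hcont.mono Set.Icc_subset_Ici_self).sub
        (continuous_id.mul continuous_const).continuousOn).add hrest.continuousOn
    · rw [interior_Icc]
      exact fun t ht => (hd t ht.1).differentiableAt.differentiableWithinAt
    · rw [interior_Icc]
      intro t ht
      rw [(hd t ht.1).deriv]
      have h := anti ht.1 hs ht.2.le
      dsimp only at h
      linarith
  have h := mono (Set.left_mem_Icc.2 hs.le) (Set.right_mem_Icc.2 hs.le) hs.le
  simp only [h0, zero_mul, sub_self, add_zero, mul_zero, zero_add] at h
  linarith
end

section
/- Let d > 0, c₁ > 0, C ≥ 0, and let φ : (0,∞) → ℝ be differentiable with φ′(t) ≤ −c₁·e^{(2/d)·φ(t)} + C for every t > 0. Then φ(t) ≤ −(d/2)·log((2c₁/d)·t) + C·t for every t > 0. -/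
/-- ODE decay estimate: if `φ' ≤ -c₁ e^{(2/d) φ} + C` on `(0,∞)`, then
`φ(t) ≤ -(d/2) log((2c₁/d) t) + C t` for every `t > 0`. -/
theorem entropy_decay_heat_flow
    (d c₁ C : ℝ) (hd : 0 < d) (hc₁ : 0 < c₁) (hC : 0 ≤ C)
    (φ : ℝ → ℝ)
    (hdiff : ∀ t > (0 : ℝ), DifferentiableAt ℝ φ t)
    (hineq : ∀ t > (0 : ℝ),
      deriv φ t ≤ -c₁ * Real.exp ((2 / d) * φ t) + C) :
    ∀ t > (0 : ℝ), φ t ≤ -(d / 2) * Real.log ((2 * c₁ / d) * t) + C * t := by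
  intro t ht
  let g : ℝ → ℝ := fun s => Real.exp (-(2 / d) * (φ s - C * s))
  have hg (s : ℝ) (hs : 0 < s) :
      HasDerivAt g (g s * (-(2 / d) * (deriv φ s - C))) s := by
    have hlin : HasDerivAt (fun s => C * s) C s := by
      simpa using (hasDerivAt_id s).const_mul C
    exact (((hdiff s hs).hasDerivAt.sub hlin).const_mul (-(2 / d))).exp
  have hg_deriv (s : ℝ) (hs : 0 < s) : 2 * c₁ / d ≤ deriv g s := by
    rw [(hg s hs).deriv]
    have hprod : 1 ≤ g s * Real.exp ((2 / d) * φ s) := by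
      rw [← Real.exp_add]
      apply Real.one_le_exp
      have : 0 ≤ (2 / d) * (C * s) := by positivity
      linarith
    calc 2 * c₁ / d = (2 / d) * c₁ * 1 := by ring
      _ ≤ (2 / d) * c₁ * (g s * Real.exp ((2 / d) * φ s)) := by gcongr
      _ = g s * (2 / d) * (c₁ * Real.exp ((2 / d) * φ s)) := by ring
      _ ≤ g s * (2 / d) * (C - deriv φ s) := by
        have : 0 < g s := Real.exp_pos _
        gcongr
        linarith [hineq s hs]
      _ = g s * (-(2 / d) * (deriv φ s - C)) := by ring
  have hincr (s : ℝ) (hs : 0 < s) (hst : s < t) : 2 * c₁ / d * (t - s) ≤ g t := by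
    have h := (convex_Ioi (0 : ℝ)).mul_sub_le_image_sub_of_le_deriv (f := g)
      (fun x hx => (hg x hx).continuousAt.continuousWithinAt)
      (fun x hx => (hg x (interior_subset hx)).differentiableAt.differentiableWithinAt)
      (fun x hx => hg_deriv x (interior_subset hx)) s hs t ht hst.le
    have : 0 < g s := Real.exp_pos _
    linarith
  have hle : 2 * c₁ / d * t ≤ g t := by
    have hlim : Filter.Tendsto (fun s => 2 * c₁ / d * (t - s)) (nhdsWithin 0 (Set.Ioi 0))
        (nhds (2 * c₁ / d * (t - 0))) :=
      (Continuous.tendsto (by fun_prop) 0).mono_left nhdsWithin_le_nhds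
    rw [sub_zero] at hlim
    refine le_of_tendsto hlim ?_
    filter_upwards [Ioo_mem_nhdsGT ht] with s hs using hincr s hs.1 hs.2
  have hlog : Real.log (2 * c₁ / d * t) ≤ -(2 / d) * (φ t - C * t) :=
    (Real.log_le_iff_le_exp (by positivity)).2 hle
  have hmul := mul_le_mul_of_nonneg_left hlog (half_pos hd).le
  have hcancel : d / 2 * (-(2 / d) * (φ t - C * t)) = -(φ t - C * t) := by
    field_simp
  linarith
end

section
/- Let T > 0, d > 0, c₄ > 0, c₅ ≥ 0, and let φ : [0,T] → ℝ be continuous on [0,T] and twice differentiable on (0,T), satisfying φ″(t) ≥ c₄·e^{(2/d)·φ(t)} − c₅ for every t ∈ (0,T). Then there exists a constant L, depending only on c₄, c₅, d, and T (and not on φ), such that φ(t) ≤ −d·log(t·(T−t)) + L for every t ∈ (0,T). -/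
/-- The second derivative is nonpositive at a local maximum. -/
theorem IsLocalMax.deriv_deriv_nonpos {f : ℝ → ℝ} {x : ℝ} (h : IsLocalMax f x)
    (hc : ContinuousAt f x) : deriv (deriv f) x ≤ 0 := by
  by_contra! hpos
  have hmin : IsLocalMin f x := isLocalMin_of_deriv_deriv_pos hpos h.deriv_eq_zero hc
  have heq : f =ᶠ[nhds x] fun _ => f x := by
    filter_upwards [h, hmin] with y h₁ h₂ using le_antisymm h₁ h₂
  have hzero : deriv (deriv f) x = 0 := by
    rw [heq.deriv.deriv_eq]
    simp
  exact hpos.ne' hzero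

/-- Adding the logarithmic barrier `d log t + d log (T - t)` to `φ` lowers the second derivative
by `d / t² + d / (T - t)²`. -/
theorem deriv_deriv_add_log_barrier {T d : ℝ} {φ : ℝ → ℝ}
    (hφ : ∀ t ∈ Set.Ioo (0 : ℝ) T, DifferentiableAt ℝ φ t) {t : ℝ} (ht : t ∈ Set.Ioo (0 : ℝ) T)
    (hφ' : DifferentiableAt ℝ (deriv φ) t) :
    deriv (deriv fun s => φ s + d * (Real.log s + Real.log (T - s))) t =
      deriv (deriv φ) t - d * (1 / t ^ 2 + 1 / (T - t) ^ 2) := by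
  have hderiv : deriv (fun s => φ s + d * (Real.log s + Real.log (T - s))) =ᶠ[nhds t]
      fun s => deriv φ s + d * (s⁻¹ - (T - s)⁻¹) := by
    filter_upwards [isOpen_Ioo.mem_nhds ht] with s hs
    have h₂ : HasDerivAt (fun s => Real.log (T - s)) (-1 / (T - s)) s :=
      ((hasDerivAt_id s).const_sub T).log (sub_pos.2 hs.2).ne'
    have h := (hφ s hs).hasDerivAt.add (((Real.hasDerivAt_log hs.1.ne').add h₂).const_mul d)
    refine h.deriv.trans ?_
    ring
  have hT : T - t ≠ 0 := (sub_pos.2 ht.2).ne'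
  have h₂ : HasDerivAt (fun s => (T - s)⁻¹) (-(-1) / (T - t) ^ 2) t :=
    ((hasDerivAt_id t).const_sub T).inv hT
  have h := hφ'.hasDerivAt.add (((hasDerivAt_inv ht.1.ne').sub h₂).const_mul d)
  rw [hderiv.deriv_eq]
  refine h.deriv.trans ?_
  ring


/-- Interior entropy bound: any subsolution of `φ'' ≥ c₄ e^{(2/d) φ} - c₅` on
`(0,T)` is bounded above by `-d log(t (T - t)) + L`, where `L` depends only on
`c₄, c₅, d, T` and not on `φ`. -/
theorem interior_entropy_bound
    (T d c₄ c₅ : ℝ) (hT : 0 < T) (hd : 0 < d) (hc₄ : 0 < c₄) (hc₅ : 0 ≤ c₅) :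
    ∃ L : ℝ, ∀ φ : ℝ → ℝ,
      ContinuousOn φ (Set.Icc 0 T) →
      (∀ t ∈ Set.Ioo (0 : ℝ) T, DifferentiableAt ℝ φ t) →
      (∀ t ∈ Set.Ioo (0 : ℝ) T, DifferentiableAt ℝ (deriv φ) t) →
      (∀ t ∈ Set.Ioo (0 : ℝ) T,
        deriv (deriv φ) t ≥ c₄ * Real.exp ((2 / d) * φ t) - c₅) →
      ∀ t ∈ Set.Ioo (0 : ℝ) T, φ t ≤ -d * Real.log (t * (T - t)) + L := by
  refine ⟨d / 2 * Real.log ((c₅ * T ^ 4 + 2 * d * T ^ 2) / c₄), ?_⟩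
  intro φ hcont hφ hφ' hineq
  have hg : ContinuousOn (fun s => Real.exp (φ s / d) * (s * (T - s))) (Set.Icc 0 T) := by
    fun_prop
  obtain ⟨m, hm, hmax⟩ := isCompact_Icc.exists_isMaxOn ⟨0, Set.left_mem_Icc.2 hT.le⟩ hg
  have hpos : ∀ s ∈ Set.Ioo (0 : ℝ) T, 0 < s * (T - s) :=
    fun s hs => mul_pos hs.1 (sub_pos.2 hs.2)
  have hm' : m ∈ Set.Ioo 0 T := by
    have hmid : T / 2 ∈ Set.Ioo 0 T := ⟨by linarith, by linarith⟩
    have h : 0 < Real.exp (φ m / d) * (m * (T - m)) :=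
      (mul_pos (Real.exp_pos _) (hpos _ hmid)).trans_le (hmax (Set.Ioo_subset_Icc_self hmid))
    refine ⟨hm.1.lt_of_ne ?_, hm.2.lt_of_ne ?_⟩
    · rintro rfl
      simp at h
    · rintro rfl
      simp at h
  let w : ℝ → ℝ := fun s => φ s + d * (Real.log s + Real.log (T - s))
  have hexp : ∀ s ∈ Set.Ioo (0 : ℝ) T,
      Real.exp (w s / d) = Real.exp (φ s / d) * (s * (T - s)) := by
    intro s hs
    have hw : w s / d = φ s / d + (Real.log s + Real.log (T - s)) := by
      simp only [w]
      field_simp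
    rw [hw, Real.exp_add, Real.exp_add, Real.exp_log hs.1, Real.exp_log (sub_pos.2 hs.2)]
  have hwmax : ∀ s ∈ Set.Ioo (0 : ℝ) T, w s ≤ w m := by
    intro s hs
    have h : Real.exp (w s / d) ≤ Real.exp (w m / d) := by
      rw [hexp s hs, hexp m hm']
      exact hmax (Set.Ioo_subset_Icc_self hs)
    rwa [Real.exp_le_exp, div_le_div_iff_of_pos_right hd] at h
  have hm0 : m ≠ 0 := hm'.1.ne'
  have hTm : T - m ≠ 0 := (sub_pos.2 hm'.2).ne'
  have hwcont : ContinuousAt w m :=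
    (hφ m hm').continuousAt.add (continuousAt_const.mul
      ((Real.continuousAt_log hm0).add
        ((continuousAt_const.sub continuousAt_id).log hTm)))
  have hwloc : IsLocalMax w m := Filter.mem_of_superset (isOpen_Ioo.mem_nhds hm') hwmax
  have hnonpos := hwloc.deriv_deriv_nonpos hwcont
  rw [deriv_deriv_add_log_barrier hφ hm' (hφ' m hm')] at hnonpos
  have hbound : c₄ * Real.exp (2 / d * φ m) ≤ c₅ + d * (1 / m ^ 2 + 1 / (T - m) ^ 2) := by
    linarith [hineq m hm']
  have hsq : Real.exp (2 / d * w m) = Real.exp (2 / d * φ m) * (m * (T - m)) ^ 2 := by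
    have h (x : ℝ) : Real.exp (2 / d * x) = Real.exp (x / d) ^ 2 := by
      rw [← Real.exp_nat_mul]
      congr 1
      push_cast
      ring
    rw [h, h, hexp m hm']
    ring
  have hmain : c₄ * Real.exp (2 / d * w m) ≤ c₅ * T ^ 4 + 2 * d * T ^ 2 := by
    have hmT : 0 ≤ T - m := sub_nonneg.2 hm.2
    calc c₄ * Real.exp (2 / d * w m)
        = c₄ * Real.exp (2 / d * φ m) * (m * (T - m)) ^ 2 := by rw [hsq]; ring
      _ ≤ (c₅ + d * (1 / m ^ 2 + 1 / (T - m) ^ 2)) * (m * (T - m)) ^ 2 := by gcongr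
      _ = c₅ * (m * (T - m)) ^ 2 + d * ((T - m) ^ 2 + m ^ 2) := by
        field_simp
      _ ≤ c₅ * (T * T) ^ 2 + d * (T ^ 2 + T ^ 2) := by
        have h₁ : m ≤ T := hm.2
        have h₂ : T - m ≤ T := sub_le_self T hm.1
        have h₀ : 0 ≤ m := hm.1
        gcongr
      _ = c₅ * T ^ 4 + 2 * d * T ^ 2 := by ring
  have hwm : w m ≤ d / 2 * Real.log ((c₅ * T ^ 4 + 2 * d * T ^ 2) / c₄) := by
    have h : 2 / d * w m ≤ Real.log ((c₅ * T ^ 4 + 2 * d * T ^ 2) / c₄) := by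
      rw [Real.le_log_iff_exp_le (by positivity), le_div_iff₀ hc₄]
      linarith
    calc w m = d / 2 * (2 / d * w m) := by field_simp
      _ ≤ _ := by gcongr
  intro t ht
  have h : φ t + d * (Real.log t + Real.log (T - t)) ≤ w m := hwmax t ht
  rw [Real.log_mul ht.1.ne' (sub_pos.2 ht.2).ne']
  linarith
end
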